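/- Fix an integer k ≥ 3 and let μ = E[X]. As n → ∞, the third central moment E[(X − μ)³] is asymptotically equivalent to (1/((k−3)!)³) · n^(3k−5) / 2^(3·C(k,2) − 3), i.e., the ratio of the two quantities tends to 1. -/

import Mathlib

/-- An edge coloring of the complete graph on `Fin n`: each 2-element subset of
vertices (edge) is colored with one of two colors (`true` = red, `false` = blue). -/
abbrev EdgeColoring (n : ℕ) : Type := {e : Finset (Fin n) // e.card = 2} → Bool

/-- `X`: the number of `k`-element vertex subsets all of whose induced edges
receive the same color (monochromatic `K_k`) in the coloring `c`. -/
def monoCount (n k : ℕ) (c : EdgeColoring n) : ℕ :=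
  ((Finset.univ.powersetCard k).filter (fun S : Finset (Fin n) => ∃ b : Bool,
    ∀ e : {e : Finset (Fin n) // e.card = 2}, (e : Finset (Fin n)) ⊆ S → c e = b)).card

/-- Expectation of `f` under the uniform distribution on all edge colorings. -/
noncomputable def expec (n : ℕ) (f : EdgeColoring n → ℝ) : ℝ :=
  (∑ c : EdgeColoring n, f c) / (Fintype.card (EdgeColoring n) : ℝ)

/-- The `m`-th central moment of the number of monochromatic `K_k`'s in a uniformly
random edge coloring of the complete graph on `n` vertices. -/
noncomputable def centralMoment (n k m : ℕ) : ℝ :=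
  expec n (fun c => ((monoCount n k c : ℝ) -
    expec n (fun c' => (monoCount n k c' : ℝ))) ^ m)


lemma expec_add (n : ℕ) (f g : EdgeColoring n → ℝ) :
    expec n (fun c => f c + g c) = expec n f + expec n g := by
  simp only [expec, Finset.sum_add_distrib, add_div]

lemma expec_const_mul (n : ℕ) (a : ℝ) (f : EdgeColoring n → ℝ) :
    expec n (fun c => a * f c) = a * expec n f := by
  simp only [expec, ← Finset.mul_sum, mul_div_assoc]

lemma expec_const (n : ℕ) (a : ℝ) : expec n (fun _ => a) = a := by
  have : (Fintype.card (EdgeColoring n) : ℝ) ≠ 0 := by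
    exact_mod_cast Fintype.card_ne_zero
  rw [expec, Finset.sum_const, nsmul_eq_mul, Finset.card_univ, mul_div_cancel_left₀ _ this]

lemma expec_sub (n : ℕ) (f g : EdgeColoring n → ℝ) :
    expec n (fun c => f c - g c) = expec n f - expec n g := by
  simp only [expec, Finset.sum_sub_distrib, sub_div]

lemma expec_sum {ι : Type*} (n : ℕ) (s : Finset ι) (f : ι → EdgeColoring n → ℝ) :
    expec n (fun c => ∑ i ∈ s, f i c) = ∑ i ∈ s, expec n (f i) := by
  simp only [expec]
  rw [Finset.sum_comm, Finset.sum_div]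

lemma abs_expec_le {n : ℕ} {f : EdgeColoring n → ℝ} {a : ℝ} (hf : ∀ c, |f c| ≤ a) :
    |expec n f| ≤ a := by
  have hpos : (0 : ℝ) < Fintype.card (EdgeColoring n) := by
    exact_mod_cast Fintype.card_pos
  rw [expec, abs_div, abs_of_pos hpos, div_le_iff₀ hpos]
  calc |∑ c, f c| ≤ ∑ c, |f c| := Finset.abs_sum_le_sum_abs _ _
    _ ≤ ∑ _c : EdgeColoring n, a := Finset.sum_le_sum fun c _ => hf c
    _ = a * Fintype.card (EdgeColoring n) := by
      rw [Finset.sum_const, nsmul_eq_mul, Finset.card_univ, mul_comm]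

/-- The colors of distinct edges are independent and uniform. -/
lemma expec_prod (n : ℕ) (g : {e : Finset (Fin n) // e.card = 2} → Bool → ℝ) :
    expec n (fun c => ∏ e, g e (c e)) = ∏ e, ((g e true + g e false) / 2) := by
  have h := Finset.prod_univ_sum (fun _ : {e : Finset (Fin n) // e.card = 2} =>
    (Finset.univ : Finset Bool)) g
  rw [Fintype.piFinset_univ] at h
  simp only [Fintype.sum_bool] at h
  rw [expec, ← h, Finset.prod_div_distrib, Finset.prod_const, Finset.card_univ]
  simp [EdgeColoring]

lemma card_edges_subset {n : ℕ} (A : Finset (Fin n)) :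
    (Finset.univ.filter fun e : {e : Finset (Fin n) // e.card = 2} => e.1 ⊆ A).card =
      A.card.choose 2 := by
  rw [← Finset.card_powersetCard, ← Finset.card_map (Function.Embedding.subtype _)]
  congr 1
  ext e
  simp [Finset.mem_powersetCard, and_comm]

lemma card_edges_subset_not_subset {n : ℕ} (A B : Finset (Fin n)) :
    (Finset.univ.filter fun e : {e : Finset (Fin n) // e.card = 2} =>
      e.1 ⊆ A ∧ ¬ e.1 ⊆ B).card = A.card.choose 2 - (A ∩ B).card.choose 2 := by
  have h := Finset.card_filter_add_card_filter_not (s := Finset.univ.filter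
    fun e : {e : Finset (Fin n) // e.card = 2} => e.1 ⊆ A) (fun e => e.1 ⊆ B)
  simp only [Finset.filter_filter, ← Finset.subset_inter_iff, card_edges_subset] at h
  omega

/-- For `β = ±1`, the product over the edges inside `S` of `1 + β` times the sign of the color. -/
noncomputable def signWeight {n : ℕ} (S : Finset (Fin n)) (β : ℝ) (c : EdgeColoring n) : ℝ :=
  ∏ e : {e : Finset (Fin n) // e.card = 2},
    if e.1 ⊆ S then 1 + β * (if c e then 1 else -1) else 1

/-- The sign attached to a color. -/
def colorSign (b : Bool) : ℝ := if b then 1 else -1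

lemma signWeight_colorSign {n : ℕ} (S : Finset (Fin n)) (b : Bool) (c : EdgeColoring n) :
    signWeight S (colorSign b) c =
      if ∀ e : {e : Finset (Fin n) // e.card = 2}, e.1 ⊆ S → c e = b
      then 2 ^ S.card.choose 2 else 0 := by
  rw [signWeight, ← Finset.prod_filter]
  split_ifs with h
  · rw [← card_edges_subset, ← Finset.prod_const]
    refine Finset.prod_congr rfl fun e he => ?_
    rw [h e (Finset.mem_filter.1 he).2]
    cases b <;> norm_num [colorSign]
  · push Not at h
    obtain ⟨e, he, hb⟩ := h
    refine Finset.prod_eq_zero (Finset.mem_filter.2 ⟨Finset.mem_univ e, he⟩) ?_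
    revert hb
    cases b <;> cases c e <;> norm_num [colorSign]

/-- The centered indicator of the event that `S` is monochromatic. -/
noncomputable def monoDev {n : ℕ} (S : Finset (Fin n)) (c : EdgeColoring n) : ℝ :=
  (if ∃ b : Bool, ∀ e : {e : Finset (Fin n) // e.card = 2}, e.1 ⊆ S → c e = b then 1 else 0) -
    2 * (1 / 2) ^ S.card.choose 2

lemma monoDev_eq {n : ℕ} {S : Finset (Fin n)} (hS : 2 ≤ S.card) (c : EdgeColoring n) :
    monoDev S c = (1 / 2) ^ S.card.choose 2 * ∑ b, (signWeight S (colorSign b) c - 1) := by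
  obtain ⟨t, ht, htc⟩ := Finset.exists_subset_card_eq hS
  have hex : ¬ ((∀ e : {e : Finset (Fin n) // e.card = 2}, e.1 ⊆ S → c e = true) ∧
      ∀ e : {e : Finset (Fin n) // e.card = 2}, e.1 ⊆ S → c e = false) := by
    rintro ⟨h1, h2⟩
    have := (h1 ⟨t, htc⟩ ht).symm.trans (h2 ⟨t, htc⟩ ht)
    simp at this
  have hpow : ((1 : ℝ) / 2) ^ S.card.choose 2 * 2 ^ S.card.choose 2 = 1 := by
    rw [← mul_pow]; norm_num
  rw [monoDev]
  simp only [Fintype.sum_bool, signWeight_colorSign, Bool.exists_bool]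
  by_cases h1 : ∀ e : {e : Finset (Fin n) // e.card = 2}, e.1 ⊆ S → c e = true <;>
  by_cases h2 : ∀ e : {e : Finset (Fin n) // e.card = 2}, e.1 ⊆ S → c e = false
  · exact absurd ⟨h1, h2⟩ hex
  · rw [if_pos (Or.inr h1), if_pos h1, if_neg h2]; linear_combination -hpow
  · rw [if_pos (Or.inl h2), if_neg h1, if_pos h2]; linear_combination -hpow
  · rw [if_neg (by tauto), if_neg h1, if_neg h2]; ring

lemma abs_monoDev_le {n : ℕ} {S : Finset (Fin n)} (hS : 2 ≤ S.card) (c : EdgeColoring n) :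
    |monoDev S c| ≤ 1 := by
  have hC : 1 ≤ S.card.choose 2 := Nat.choose_pos hS
  have h1 : ((1 : ℝ) / 2) ^ S.card.choose 2 ≤ 1 / 2 :=
    pow_le_of_le_one (by norm_num) (by norm_num) (by omega)
  have h0 : (0 : ℝ) ≤ (1 / 2) ^ S.card.choose 2 := by positivity
  rw [monoDev, abs_le]
  split_ifs <;> constructor <;> linarith

lemma expec_signWeight_mul_mul {n : ℕ} (S T U : Finset (Fin n)) (β γ δ : ℝ) :
    expec n (fun c => signWeight S β c * signWeight T γ c * signWeight U δ c) =
      (1 + β * γ) ^ ((S ∩ T).card.choose 2 - (S ∩ T ∩ U).card.choose 2) *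
      (1 + γ * δ) ^ ((T ∩ U).card.choose 2 - (S ∩ T ∩ U).card.choose 2) *
      (1 + β * δ) ^ ((S ∩ U).card.choose 2 - (S ∩ T ∩ U).card.choose 2) *
      (1 + β * γ + γ * δ + β * δ) ^ (S ∩ T ∩ U).card.choose 2 := by
  have e2 : T ∩ U ∩ S = S ∩ T ∩ U := by rw [Finset.inter_comm, Finset.inter_assoc]
  have e3 : S ∩ U ∩ T = S ∩ T ∩ U := Finset.inter_right_comm _ _ _
  simp only [signWeight, ← Finset.prod_mul_distrib]
  rw [expec_prod n (fun e b => (if e.1 ⊆ S then 1 + β * (if b then 1 else -1) else 1) *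
    (if e.1 ⊆ T then 1 + γ * (if b then 1 else -1) else 1) *
    (if e.1 ⊆ U then 1 + δ * (if b then 1 else -1) else 1))]
  rw [← card_edges_subset_not_subset (S ∩ T) U]
  nth_rw 1 [← e2]
  rw [← card_edges_subset_not_subset (T ∩ U) S]
  nth_rw 1 [← e3]
  rw [← card_edges_subset_not_subset (S ∩ U) T, ← card_edges_subset]
  simp only [← Finset.prod_const, Finset.prod_filter, ← Finset.prod_mul_distrib]
  refine Finset.prod_congr rfl fun e _ => ?_
  simp only [Finset.subset_inter_iff]
  by_cases hS : e.1 ⊆ S <;> by_cases hT : e.1 ⊆ T <;> by_cases hU : e.1 ⊆ U <;>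
    simp [hS, hT, hU] <;> ring

lemma signWeight_empty {n : ℕ} (β : ℝ) (c : EdgeColoring n) : signWeight ∅ β c = 1 := by
  rw [signWeight]
  refine Finset.prod_eq_one fun e _ => if_neg fun h => ?_
  have := e.2
  simp [Finset.subset_empty.1 h] at this

lemma expec_signWeight_mul {n : ℕ} (S T : Finset (Fin n)) (β γ : ℝ) :
    expec n (fun c => signWeight S β c * signWeight T γ c) =
      (1 + β * γ) ^ (S ∩ T).card.choose 2 := by
  simpa [signWeight_empty] using expec_signWeight_mul_mul S T ∅ β γ 0

lemma expec_signWeight {n : ℕ} (S : Finset (Fin n)) (β : ℝ) : expec n (signWeight S β) = 1 := by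
  simpa [signWeight_empty] using expec_signWeight_mul S ∅ β 0

lemma expec_monoDev {n : ℕ} {S : Finset (Fin n)} (hS : 2 ≤ S.card) :
    expec n (monoDev S) = 0 := by
  have h : monoDev S = fun c => (1 / 2) ^ S.card.choose 2 *
      ∑ b, (signWeight S (colorSign b) c - 1) := funext (monoDev_eq hS)
  rw [h, expec_const_mul, expec_sum]
  simp [expec_sub, expec_const, expec_signWeight]

/-- The mixed moment of three centered sign weights, in terms of the sizes `x, y, z` of the pairwise
intersections and the size `t` of the triple intersection of their vertex sets. -/
def mixedMoment (x y z t : ℕ) (β γ δ : ℝ) : ℝ :=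
  (1 + β * γ) ^ (x.choose 2 - t.choose 2) * (1 + γ * δ) ^ (y.choose 2 - t.choose 2) *
    (1 + β * δ) ^ (z.choose 2 - t.choose 2) * (1 + β * γ + γ * δ + β * δ) ^ t.choose 2 -
  (1 + β * γ) ^ x.choose 2 - (1 + γ * δ) ^ y.choose 2 - (1 + β * δ) ^ z.choose 2 + 2

lemma expec_signWeight_sub_one {n : ℕ} (S T U : Finset (Fin n)) (β γ δ : ℝ) :
    expec n (fun c => (signWeight S β c - 1) * (signWeight T γ c - 1) * (signWeight U δ c - 1)) =
      mixedMoment (S ∩ T).card (T ∩ U).card (S ∩ U).card (S ∩ T ∩ U).card β γ δ := by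
  have h : (fun c => (signWeight S β c - 1) * (signWeight T γ c - 1) * (signWeight U δ c - 1)) =
      fun c => signWeight S β c * signWeight T γ c * signWeight U δ c -
        signWeight S β c * signWeight T γ c - signWeight T γ c * signWeight U δ c -
        signWeight S β c * signWeight U δ c + signWeight S β c + signWeight T γ c +
        signWeight U δ c - 1 := by
    funext c; ring
  rw [h]
  simp only [expec_sub, expec_add, expec_const, expec_signWeight, expec_signWeight_mul,
    expec_signWeight_mul_mul, mixedMoment]
  ring

lemma expec_monoDev_mul_mul {n k : ℕ} (hk : 2 ≤ k) {S T U : Finset (Fin n)} (hS : S.card = k)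
    (hT : T.card = k) (hU : U.card = k) :
    expec n (fun c => monoDev S c * monoDev T c * monoDev U c) =
      (1 / 2) ^ (3 * k.choose 2) * ∑ b, ∑ b', ∑ b'',
        mixedMoment (S ∩ T).card (T ∩ U).card (S ∩ U).card (S ∩ T ∩ U).card
          (colorSign b) (colorSign b') (colorSign b'') := by
  have h : (fun c => monoDev S c * monoDev T c * monoDev U c) = fun c =>
      (1 / 2) ^ (3 * k.choose 2) * ∑ b, ∑ b', ∑ b'', (signWeight S (colorSign b) c - 1) *
        (signWeight T (colorSign b') c - 1) * (signWeight U (colorSign b'') c - 1) := by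
    funext c
    rw [monoDev_eq (hS ▸ hk), monoDev_eq (hT ▸ hk), monoDev_eq (hU ▸ hk), hS, hT, hU]
    simp only [Fintype.sum_bool]
    ring
  rw [h, expec_const_mul]
  simp only [expec_sum, expec_signWeight_sub_one]

lemma sum_mixedMoment {x y z t : ℕ} (hx : t ≤ x) (hy : t ≤ y) (hz : t ≤ z)
    (h : x + y + z ≤ 5 + t) :
    ∑ b, ∑ b', ∑ b'', mixedMoment x y z t (colorSign b) (colorSign b') (colorSign b'') =
      if x = 2 ∧ y = 2 ∧ z = 2 ∧ t = 1 then 8 else 0 := by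
  have ht : t ≤ 2 := by omega
  have hx' : x ≤ 5 := by omega
  have hy' : y ≤ 5 := by omega
  have hz' : z ≤ 5 := by omega
  simp only [Fintype.sum_bool, mixedMoment, colorSign]
  interval_cases t <;> interval_cases x <;> interval_cases y <;>
    first
    | omega
    | (interval_cases z <;> first | omega | norm_num [Nat.choose])

lemma card_union_three {n : ℕ} (S T U : Finset (Fin n)) :
    (S ∪ T ∪ U).card + (S ∩ T).card + (T ∩ U).card + (S ∩ U).card =
      S.card + T.card + U.card + (S ∩ T ∩ U).card := by
  have h1 := Finset.card_union_add_card_inter S T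
  have h2 := Finset.card_union_add_card_inter (S ∪ T) U
  have h3 := Finset.card_union_add_card_inter (S ∩ U) (T ∩ U)
  rw [Finset.union_inter_distrib_right] at h2
  rw [← Finset.inter_inter_distrib_right] at h3
  omega

/-- Three vertex sets which pairwise meet in two vertices, with exactly one common vertex. -/
def IsStar {n : ℕ} (S T U : Finset (Fin n)) : Prop :=
  (S ∩ T).card = 2 ∧ (T ∩ U).card = 2 ∧ (S ∩ U).card = 2 ∧ (S ∩ T ∩ U).card = 1

instance {n : ℕ} (S T U : Finset (Fin n)) : Decidable (IsStar S T U) := by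
  unfold IsStar; infer_instance

lemma expec_monoDev_of_large {n k : ℕ} (hk : 2 ≤ k) {S T U : Finset (Fin n)} (hS : S.card = k)
    (hT : T.card = k) (hU : U.card = k) (h : 3 * k ≤ (S ∪ T ∪ U).card + 5) :
    expec n (fun c => monoDev S c * monoDev T c * monoDev U c) =
      if IsStar S T U then 8 * (1 / 2) ^ (3 * k.choose 2) else 0 := by
  have hc := card_union_three S T U
  rw [expec_monoDev_mul_mul hk hS hT hU, sum_mixedMoment
    (Finset.card_le_card (by grind)) (Finset.card_le_card (by grind))
    (Finset.card_le_card (by grind)) (by omega)]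
  by_cases hs : IsStar S T U
  · have hs' := hs
    unfold IsStar at hs'
    rw [if_pos hs, if_pos hs', mul_comm]
  · have hs' := hs
    unfold IsStar at hs'
    rw [if_neg hs, if_neg hs', mul_zero]

lemma card_filter_card_biUnion_le {ι : Type*} [Fintype ι] [DecidableEq ι] {n r : ℕ} (hr : r ≤ n) :
    (Finset.univ.filter fun f : ι → Finset (Fin n) => (Finset.univ.biUnion f).card ≤ r).card ≤
      n ^ r * (2 ^ r) ^ Fintype.card ι := by
  have hsub : (Finset.univ.filter fun f : ι → Finset (Fin n) =>
      (Finset.univ.biUnion f).card ≤ r) ⊆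
      (Finset.powersetCard r (Finset.univ : Finset (Fin n))).biUnion
        fun V => Fintype.piFinset fun _ : ι => V.powerset := by
    intro f hf
    obtain ⟨V, hfV, -, hV⟩ := Finset.exists_subsuperset_card_eq
      (Finset.subset_univ (Finset.univ.biUnion f)) (Finset.mem_filter.1 hf).2 (by simpa using hr)
    simp only [Finset.mem_biUnion, Finset.mem_powersetCard, Fintype.mem_piFinset,
      Finset.mem_powerset]
    exact ⟨V, ⟨Finset.subset_univ V, hV⟩, fun i =>
      (Finset.subset_biUnion_of_mem f (Finset.mem_univ i)).trans hfV⟩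
  refine (Finset.card_le_card hsub).trans ((Finset.card_biUnion_le_card_mul _ _
    ((2 ^ r) ^ Fintype.card ι) fun V hV => ?_).trans ?_)
  · simp [Finset.card_powerset, (Finset.mem_powersetCard.1 hV).2]
  · rw [Finset.card_powersetCard, Finset.card_univ, Fintype.card_fin]
    exact Nat.mul_le_mul_right _ (Nat.choose_le_pow _ _)

lemma card_biUnion_lt_of_not_pairwise_disjoint {ι α : Type*} [Fintype ι] [DecidableEq ι]
    [DecidableEq α] {f : ι → Finset α} (h : ¬ Pairwise (Function.onFun Disjoint f)) :
    (Finset.univ.biUnion f).card < ∑ i, (f i).card := by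
  simp only [Pairwise, Function.onFun, not_forall, Finset.not_disjoint_iff] at h
  obtain ⟨i, j, hij, x, hxi, hxj⟩ := h
  have hsub : Finset.univ.biUnion f ⊆
      Finset.univ.biUnion (Function.update f i ((f i).erase x)) := by
    intro y hy
    obtain ⟨l, -, hl⟩ := Finset.mem_biUnion.1 hy
    rw [Finset.mem_biUnion]
    by_cases hyx : y = x
    · exact ⟨j, Finset.mem_univ j, by rwa [Function.update_of_ne hij.symm, hyx]⟩
    · refine ⟨l, Finset.mem_univ l, ?_⟩
      by_cases hli : l = i
      · subst hli
        rw [Function.update_self]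
        exact Finset.mem_erase.2 ⟨hyx, hl⟩
      · rwa [Function.update_of_ne hli]
  refine (Finset.card_le_card hsub).trans_lt (Finset.card_biUnion_le.trans_lt ?_)
  refine Finset.sum_lt_sum (fun l _ => ?_) ⟨i, Finset.mem_univ i, ?_⟩
  · by_cases hli : l = i
    · subst hli
      rw [Function.update_self]
      exact Finset.card_erase_le
    · rw [Function.update_of_ne hli]
  · rw [Function.update_self]
    exact Finset.card_erase_lt_of_mem hxi

lemma tendsto_choose_div_pow (r : ℕ) :
    Filter.Tendsto (fun n : ℕ => (n.choose r : ℝ) / (n : ℝ) ^ r) Filter.atTop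
      (nhds (1 / (r.factorial : ℝ))) := by
  have h := (isEquivalent_choose r).div
    (Asymptotics.IsEquivalent.refl (u := fun n : ℕ => (n : ℝ) ^ r))
  refine (Asymptotics.IsEquivalent.tendsto_nhds_iff h).2 ?_
  refine tendsto_const_nhds.congr' ?_
  filter_upwards [Filter.eventually_gt_atTop 0] with n hn
  have : (n : ℝ) ^ r ≠ 0 := by positivity
  simp only [Pi.div_apply]
  field_simp

lemma tendsto_of_abs_sub_le_pow {u v : ℕ → ℝ} {a K : ℝ} {r : ℕ} (hr : 1 ≤ r)
    (hv : Filter.Tendsto (fun n => v n / (n : ℝ) ^ r) Filter.atTop (nhds a))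
    (h : ∀ᶠ n : ℕ in Filter.atTop, |u n - v n| ≤ K * (n : ℝ) ^ (r - 1)) :
    Filter.Tendsto (fun n => u n / (n : ℝ) ^ r) Filter.atTop (nhds a) := by
  have hz : Filter.Tendsto (fun n => (u n - v n) / (n : ℝ) ^ r) Filter.atTop (nhds 0) := by
    refine squeeze_zero_norm' ?_ (tendsto_const_div_atTop_nhds_zero_nat K)
    filter_upwards [h, Filter.eventually_gt_atTop 0] with n hn hpos
    have hn0 : (0 : ℝ) < n := by exact_mod_cast hpos
    rw [Real.norm_eq_abs, abs_div, abs_of_pos (pow_pos hn0 r), div_le_div_iff₀ (by positivity) hn0]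
    calc |u n - v n| * n ≤ K * (n : ℝ) ^ (r - 1) * n := by gcongr
      _ = K * (n : ℝ) ^ r := by rw [mul_assoc, ← pow_succ, Nat.sub_add_cancel hr]
  simpa [← add_div] using hz.add hv

open Classical in
/-- The families of pairwise disjoint subsets of `Fin n` with prescribed sizes. -/
noncomputable def disjointFamilies {ι : Type*} [Fintype ι] (n : ℕ) (r : ι → ℕ) :
    Finset (ι → Finset (Fin n)) :=
  Finset.univ.filter fun f => (∀ i, (f i).card = r i) ∧ Pairwise (Function.onFun Disjoint f)

lemma mem_disjointFamilies {ι : Type*} [Fintype ι] {n : ℕ} {r : ι → ℕ}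
    {f : ι → Finset (Fin n)} : f ∈ disjointFamilies n r ↔
      (∀ i, (f i).card = r i) ∧ Pairwise (Function.onFun Disjoint f) := by
  simp [disjointFamilies]

lemma tendsto_card_disjointFamilies {ι : Type*} [Fintype ι] [DecidableEq ι] (r : ι → ℕ)
    (hr : 1 ≤ ∑ i, r i) :
    Filter.Tendsto (fun n : ℕ => ((disjointFamilies n r).card : ℝ) / (n : ℝ) ^ ∑ i, r i)
      Filter.atTop (nhds (∏ i, 1 / ((r i).factorial : ℝ))) := by
  refine tendsto_of_abs_sub_le_pow (v := fun n => ∏ i, (n.choose (r i) : ℝ))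
    (K := (2 ^ (∑ i, r i - 1)) ^ Fintype.card ι) hr ?_ ?_
  · have h := tendsto_finsetProd (Finset.univ : Finset ι)
      fun i _ => tendsto_choose_div_pow (r i)
    simpa only [Finset.prod_div_distrib, Finset.prod_pow_eq_pow_sum] using h
  · filter_upwards [Filter.eventually_ge_atTop (∑ i, r i)] with n hn
    have hgood : disjointFamilies n r ⊆ Fintype.piFinset fun i =>
        Finset.powersetCard (r i) (Finset.univ : Finset (Fin n)) := by
      intro f hf
      simpa [Finset.mem_powersetCard] using (mem_disjointFamilies.1 hf).1
    have hbad : (Fintype.piFinset fun i => Finset.powersetCard (r i)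
        (Finset.univ : Finset (Fin n))) \ disjointFamilies n r ⊆
        Finset.univ.filter fun f : ι → Finset (Fin n) =>
          (Finset.univ.biUnion f).card ≤ ∑ i, r i - 1 := by
      intro f hf
      simp only [mem_disjointFamilies, Finset.mem_sdiff, Fintype.mem_piFinset,
        Finset.mem_powersetCard, Finset.subset_univ, true_and, Finset.mem_filter,
        Finset.mem_univ, not_and] at hf ⊢
      have := card_biUnion_lt_of_not_pairwise_disjoint (hf.2 hf.1)
      simp only [hf.1] at this
      omega
    have hle := (Finset.card_le_card hbad).trans
      (card_filter_card_biUnion_le (ι := ι) (show ∑ i, r i - 1 ≤ n by omega))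
    have hsum := Finset.card_sdiff_add_card_eq_card hgood
    rw [Fintype.card_piFinset] at hsum
    simp only [Finset.card_powersetCard, Finset.card_univ, Fintype.card_fin] at hsum
    have hsum' : (∏ i, (n.choose (r i) : ℝ)) = (((Fintype.piFinset fun i => Finset.powersetCard (r i)
        (Finset.univ : Finset (Fin n))) \ disjointFamilies n r).card : ℝ) +
        (disjointFamilies n r).card := by exact_mod_cast hsum.symm
    rw [hsum', abs_sub_comm, add_sub_cancel_right, Nat.abs_cast, mul_comm]
    exact_mod_cast hle

/-- The triples of `k`-subsets of `Fin n` in star position. -/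
def starTriples (n k : ℕ) : Finset (Fin 3 → Finset (Fin n)) :=
  (Fintype.piFinset fun _ => Finset.powersetCard k Finset.univ).filter
    fun f => IsStar (f 0) (f 1) (f 2)

lemma mem_starTriples {n k : ℕ} {f : Fin 3 → Finset (Fin n)} : f ∈ starTriples n k ↔
    (∀ i, (f i).card = k) ∧ IsStar (f 0) (f 1) (f 2) := by
  simp [starTriples, Finset.mem_powersetCard]

/-- The regions of the Venn diagram of three sets. -/
def vennRegions {α : Type*} [DecidableEq α] (f : Fin 3 → Finset α) : Fin 7 → Finset α :=
  ![f 0 ∩ f 1 ∩ f 2, (f 0 ∩ f 1) \ f 2, (f 1 ∩ f 2) \ f 0, (f 0 ∩ f 2) \ f 1,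
    f 0 \ (f 1 ∪ f 2), f 1 \ (f 0 ∪ f 2), f 2 \ (f 0 ∪ f 1)]

/-- The three sets with given regions of their Venn diagram. -/
def ofVennRegions {α : Type*} [DecidableEq α] (g : Fin 7 → Finset α) : Fin 3 → Finset α :=
  ![g 0 ∪ g 1 ∪ g 3 ∪ g 4, g 0 ∪ g 1 ∪ g 2 ∪ g 5, g 0 ∪ g 2 ∪ g 3 ∪ g 6]

lemma ofVennRegions_vennRegions {α : Type*} [DecidableEq α] (f : Fin 3 → Finset α) :
    ofVennRegions (vennRegions f) = f := by
  funext i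
  fin_cases i <;> simp [ofVennRegions, vennRegions] <;> grind

lemma pairwise_disjoint_vennRegions {α : Type*} [DecidableEq α] (f : Fin 3 → Finset α) :
    Pairwise (Function.onFun Disjoint (vennRegions f)) := by
  intro i j hij
  rw [Function.onFun, Finset.disjoint_left]
  intro x hi hj
  fin_cases i <;> fin_cases j <;> simp [vennRegions] at hij hi hj <;> tauto

lemma vennRegions_ofVennRegions {α : Type*} [DecidableEq α] {g : Fin 7 → Finset α}
    (hg : Pairwise (Function.onFun Disjoint g)) : vennRegions (ofVennRegions g) = g := by
  funext i
  ext x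
  by_cases hx : ∃ j, x ∈ g j
  · obtain ⟨j, hj⟩ := hx
    have h : ∀ l, x ∈ g l ↔ l = j := fun l =>
      ⟨fun hl => by_contra fun hlj => Finset.disjoint_left.1 (hg hlj) hl hj, fun hl => hl ▸ hj⟩
    fin_cases i <;> simp [ofVennRegions, vennRegions, h] <;> clear h hj <;>
      revert j <;> decide
  · push Not at hx
    fin_cases i <;> simp [ofVennRegions, vennRegions, hx]

lemma card_vennRegions {α : Type*} [DecidableEq α] (f : Fin 3 → Finset α) :
    (f 0).card = (vennRegions f 0).card + (vennRegions f 1).card + (vennRegions f 3).card +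
      (vennRegions f 4).card ∧
    (f 1).card = (vennRegions f 0).card + (vennRegions f 1).card + (vennRegions f 2).card +
      (vennRegions f 5).card ∧
    (f 2).card = (vennRegions f 0).card + (vennRegions f 2).card + (vennRegions f 3).card +
      (vennRegions f 6).card ∧
    (f 0 ∩ f 1).card = (vennRegions f 0).card + (vennRegions f 1).card ∧
    (f 1 ∩ f 2).card = (vennRegions f 0).card + (vennRegions f 2).card ∧
    (f 0 ∩ f 2).card = (vennRegions f 0).card + (vennRegions f 3).card ∧
    (f 0 ∩ f 1 ∩ f 2).card = (vennRegions f 0).card := by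
  have hd : ∀ i j, i ≠ j → Disjoint (vennRegions f i) (vennRegions f j) :=
    fun i j hij => pairwise_disjoint_vennRegions f hij
  have hcard : ∀ a b c d : Fin 7, a ≠ b → a ≠ c → a ≠ d → b ≠ c → b ≠ d → c ≠ d →
      (vennRegions f a ∪ vennRegions f b ∪ vennRegions f c ∪ vennRegions f d).card =
      (vennRegions f a).card + (vennRegions f b).card + (vennRegions f c).card +
        (vennRegions f d).card := by
    intro a b c d hab hac had hbc hbd hcd
    rw [Finset.card_union_of_disjoint, Finset.card_union_of_disjoint,
      Finset.card_union_of_disjoint (hd a b hab)] <;>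
    simp [Finset.disjoint_union_left, *]
  have h := ofVennRegions_vennRegions f
  refine ⟨?_, ?_, ?_, ?_, ?_, ?_, rfl⟩
  · rw [← hcard 0 1 3 4 (by decide) (by decide) (by decide) (by decide) (by decide) (by decide)]
    exact congrArg Finset.card (congrFun h 0).symm
  · rw [← hcard 0 1 2 5 (by decide) (by decide) (by decide) (by decide) (by decide) (by decide)]
    exact congrArg Finset.card (congrFun h 1).symm
  · rw [← hcard 0 2 3 6 (by decide) (by decide) (by decide) (by decide) (by decide) (by decide)]
    exact congrArg Finset.card (congrFun h 2).symm
  · rw [← Finset.card_union_of_disjoint (hd 0 1 (by decide))]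
    congr 1
    simp [vennRegions]
    grind
  · rw [← Finset.card_union_of_disjoint (hd 0 2 (by decide))]
    congr 1
    simp [vennRegions]
    grind
  · rw [← Finset.card_union_of_disjoint (hd 0 3 (by decide))]
    congr 1
    simp [vennRegions]
    grind

lemma mem_starTriples_iff_vennRegions {n k : ℕ} (hk : 3 ≤ k) {f : Fin 3 → Finset (Fin n)} :
    f ∈ starTriples n k ↔
      ∀ i, (vennRegions f i).card = (![1, 1, 1, 1, k - 3, k - 3, k - 3] : Fin 7 → ℕ) i := by
  obtain ⟨h0, h1, h2, h01, h12, h02, h012⟩ := card_vennRegions f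
  rw [mem_starTriples, IsStar, h01, h12, h02, h012]
  simp only [Fin.forall_fin_succ, IsEmpty.forall_iff]
  simp
  rw [h0, h1, h2]
  constructor
  · rintro ⟨⟨_, _, _⟩, _, _, _, _⟩
    refine ⟨?_, ?_, ?_, ?_, ?_, ?_, ?_⟩ <;> omega
  · rintro ⟨_, _, _, _, _, _, _⟩
    refine ⟨⟨?_, ?_, ?_⟩, ?_, ?_, ?_, ?_⟩ <;> omega

lemma card_starTriples {n k : ℕ} (hk : 3 ≤ k) :
    (starTriples n k).card =
      (disjointFamilies n ![1, 1, 1, 1, k - 3, k - 3, k - 3]).card := by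
  refine Finset.card_nbij' vennRegions ofVennRegions ?_ ?_ ?_ ?_
  · intro f hf
    exact mem_disjointFamilies.2 ⟨(mem_starTriples_iff_vennRegions hk).1 hf,
      pairwise_disjoint_vennRegions f⟩
  · intro g hg
    obtain ⟨hc, hd⟩ := mem_disjointFamilies.1 hg
    refine (mem_starTriples_iff_vennRegions hk).2 ?_
    rwa [vennRegions_ofVennRegions hd]
  · intro f _
    exact ofVennRegions_vennRegions f
  · intro g hg
    exact vennRegions_ofVennRegions (mem_disjointFamilies.1 hg).2

lemma tendsto_card_starTriples {k : ℕ} (hk : 3 ≤ k) :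
    Filter.Tendsto (fun n : ℕ => ((starTriples n k).card : ℝ) / (n : ℝ) ^ (3 * k - 5))
      Filter.atTop (nhds (1 / ((k - 3).factorial : ℝ) ^ 3)) := by
  have hsum : ∑ i, (![1, 1, 1, 1, k - 3, k - 3, k - 3] : Fin 7 → ℕ) i = 3 * k - 5 := by
    simp [Fin.sum_univ_succ]
    omega
  have h := tendsto_card_disjointFamilies (![1, 1, 1, 1, k - 3, k - 3, k - 3] : Fin 7 → ℕ)
    (by omega)
  rw [hsum] at h
  simp only [card_starTriples hk]
  convert h using 2
  simp [Fin.prod_univ_succ]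
  ring

lemma centralMoment_three_eq {n k : ℕ} (hk : 2 ≤ k) :
    centralMoment n k 3 =
      ∑ f ∈ Fintype.piFinset fun _ : Fin 3 => Finset.powersetCard k (Finset.univ : Finset (Fin n)),
        expec n (fun c => monoDev (f 0) c * monoDev (f 1) c * monoDev (f 2) c) := by
  set P := Finset.powersetCard k (Finset.univ : Finset (Fin n))
  have hcount : ∀ c, (monoCount n k c : ℝ) =
      ∑ S ∈ P, monoDev S c + P.card * (2 * (1 / 2) ^ k.choose 2) := by
    intro c
    rw [monoCount, ← Finset.sum_boole, ← nsmul_eq_mul, ← Finset.sum_const,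
      ← Finset.sum_add_distrib]
    refine Finset.sum_congr rfl fun S hS => ?_
    rw [monoDev, (Finset.mem_powersetCard.1 hS).2, sub_add_cancel]
  have hmean : expec n (fun c => (monoCount n k c : ℝ)) =
      P.card * (2 * (1 / 2) ^ k.choose 2) := by
    simp only [hcount, expec_add, expec_const, expec_sum]
    rw [Finset.sum_eq_zero, zero_add]
    intro S hS
    exact expec_monoDev ((Finset.mem_powersetCard.1 hS).2 ▸ hk)
  rw [centralMoment, hmean, ← expec_sum]
  congr 1
  funext c
  rw [hcount, add_sub_cancel_right, Finset.sum_pow']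
  simp only [Fin.prod_univ_three]

lemma abs_centralMoment_three_sub_le {n k : ℕ} (hk : 2 ≤ k) (hn : 3 * k - 5 - 1 ≤ n) :
    |centralMoment n k 3 - 8 * (1 / 2) ^ (3 * k.choose 2) * (starTriples n k).card| ≤
      (2 ^ (3 * k - 5 - 1)) ^ 3 * (n : ℝ) ^ (3 * k - 5 - 1) := by
  set A := Fintype.piFinset fun _ : Fin 3 => Finset.powersetCard k (Finset.univ : Finset (Fin n))
    with hA
  set B := Finset.univ.filter fun f : Fin 3 → Finset (Fin n) =>
    (Finset.univ.biUnion f).card ≤ 3 * k - 5 - 1 with hB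
  have hunion : ∀ f : Fin 3 → Finset (Fin n), Finset.univ.biUnion f = f 0 ∪ f 1 ∪ f 2 := by
    intro f
    ext x
    simp [Fin.exists_fin_succ]
  have hstar : 8 * (1 / 2 : ℝ) ^ (3 * k.choose 2) * (starTriples n k).card =
      ∑ f ∈ A, if IsStar (f 0) (f 1) (f 2) then 8 * (1 / 2 : ℝ) ^ (3 * k.choose 2) else 0 := by
    rw [← Finset.sum_filter, Finset.sum_const, nsmul_eq_mul, mul_comm]
    rfl
  rw [centralMoment_three_eq hk, hstar, ← Finset.sum_sub_distrib]
  have hterm : ∀ f ∈ A, |expec n (fun c => monoDev (f 0) c * monoDev (f 1) c * monoDev (f 2) c) -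
      if IsStar (f 0) (f 1) (f 2) then 8 * (1 / 2 : ℝ) ^ (3 * k.choose 2) else 0| ≤
      if f ∈ B then 1 else 0 := by
    intro f hf
    have hc : ∀ i, (f i).card = k := by simpa [hA, Finset.mem_powersetCard] using hf
    have hU := card_union_three (f 0) (f 1) (f 2)
    rw [hc, hc, hc] at hU
    by_cases hfB : f ∈ B
    · have hle : (f 0 ∪ f 1 ∪ f 2).card ≤ 3 * k - 5 - 1 := by
        rw [← hunion]
        exact (Finset.mem_filter.1 hfB).2
      have hns : ¬ IsStar (f 0) (f 1) (f 2) := by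
        rintro ⟨h1, h2, h3, h4⟩
        omega
      rw [if_neg hns, if_pos hfB, sub_zero]
      refine abs_expec_le fun c => ?_
      rw [abs_mul, abs_mul]
      exact mul_le_one₀ (mul_le_one₀ (abs_monoDev_le (hc 0 ▸ hk) c) (abs_nonneg _)
        (abs_monoDev_le (hc 1 ▸ hk) c)) (abs_nonneg _) (abs_monoDev_le (hc 2 ▸ hk) c)
    · have hgt : ¬ (f 0 ∪ f 1 ∪ f 2).card ≤ 3 * k - 5 - 1 := by
        rw [← hunion]
        exact fun h => hfB (Finset.mem_filter.2 ⟨Finset.mem_univ f, h⟩)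
      rw [expec_monoDev_of_large hk (hc 0) (hc 1) (hc 2) (by omega), sub_self, abs_zero,
        if_neg hfB]
  calc _ ≤ ∑ f ∈ A, _ := Finset.abs_sum_le_sum_abs _ _
    _ ≤ ∑ f ∈ A, if f ∈ B then (1 : ℝ) else 0 := Finset.sum_le_sum hterm
    _ = ((A.filter fun f => f ∈ B).card : ℝ) := by rw [Finset.sum_boole]
    _ ≤ (B.card : ℝ) := by
      exact_mod_cast Finset.card_le_card fun f hf => (Finset.mem_filter.1 hf).2
    _ ≤ _ := by
      rw [mul_comm]
      exact_mod_cast card_filter_card_biUnion_le (ι := Fin 3) hn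

lemma tendsto_centralMoment_three_div_pow {k : ℕ} (hk : 3 ≤ k) :
    Filter.Tendsto (fun n : ℕ => centralMoment n k 3 / (n : ℝ) ^ (3 * k - 5)) Filter.atTop
      (nhds (8 * (1 / 2) ^ (3 * k.choose 2) * (1 / ((k - 3).factorial : ℝ) ^ 3))) := by
  refine tendsto_of_abs_sub_le_pow (by omega) ?_ ?_
    (v := fun n => 8 * (1 / 2) ^ (3 * k.choose 2) * (starTriples n k).card)
    (K := (2 ^ (3 * k - 5 - 1)) ^ 3)
  · simpa only [mul_div_assoc] using (tendsto_card_starTriples hk).const_mul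
      (8 * (1 / 2) ^ (3 * k.choose 2))
  · filter_upwards [Filter.eventually_ge_atTop (3 * k - 5 - 1)] with n hn
    exact abs_centralMoment_three_sub_le (by omega) hn

theorem third_central_moment_asymptotic (k : ℕ) (hk : 3 ≤ k) :
    Filter.Tendsto (fun n : ℕ =>
      centralMoment n k 3 /
        ((1 / ((k - 3).factorial : ℝ) ^ 3) * (n : ℝ) ^ (3 * k - 5) /
          (2 : ℝ) ^ (3 * k.choose 2 - 3)))
      Filter.atTop (nhds 1) := by
  have hC : 1 ≤ k.choose 2 := Nat.choose_pos (by omega)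
  have hpow : (8 : ℝ) * (1 / 2) ^ (3 * k.choose 2) = 1 / 2 ^ (3 * k.choose 2 - 3) := by
    obtain ⟨m, hm⟩ : ∃ m, 3 * k.choose 2 = m + 3 := ⟨3 * k.choose 2 - 3, by omega⟩
    rw [hm, Nat.add_sub_cancel, pow_add, one_div_pow]
    ring
  have hf : ((k - 3).factorial : ℝ) ≠ 0 := by positivity
  have h := (tendsto_centralMoment_three_div_pow hk).div_const
    (8 * (1 / 2) ^ (3 * k.choose 2) * (1 / ((k - 3).factorial : ℝ) ^ 3))
  rw [div_self (by positivity)] at h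
  refine h.congr fun n => ?_
  rw [hpow, div_div]
  congr 1
  ring
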